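/- arXiv:1605.05276 — 2 statements merged into one kernel-verified Lean document; each statement's English description precedes it below -/
import Mathlib

section
/- Let X be a Bing compactum and let Y be a hereditarily locally connected compact metrizable space. Suppose there exist a dense linear subspace E of C_p(X) and a continuous linear map T : E → C_p(Y) whose image is dense in C_p(Y). Then Y is totally disconnected. -/
/-- `Cp X` is the space of continuous real-valued functions on `X`, as a submodule of
`X → ℝ`; its coercion to a type carries the subspace topology induced from the product
topology on `X → ℝ`, i.e. the topology of pointwise convergence. -/
def Cp (X : Type*) [TopologicalSpace X] : Submodule ℝ (X → ℝ) where
  carrier := {f | Continuous f}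
  add_mem' hf hg := hf.add hg
  zero_mem' := continuous_const
  smul_mem' c _f hf := hf.const_smul c

/-- A subcontinuum of a space: a nonempty compact connected subset. -/
def IsSubcontinuum {X : Type*} [TopologicalSpace X] (K : Set X) : Prop :=
  IsCompact K ∧ IsConnected K

/-- A set `C` is hereditarily indecomposable if for every subcontinuum `K ⊆ C` and all
subcontinua `A, B ⊆ K` with `A ∪ B = K`, one has `A = K` or `B = K`. -/
def HereditarilyIndecomposable {X : Type*} [TopologicalSpace X] (C : Set X) : Prop :=
  ∀ K ⊆ C, IsSubcontinuum K →
    ∀ A ⊆ K, ∀ B ⊆ K, IsSubcontinuum A → IsSubcontinuum B → A ∪ B = K → A = K ∨ B = K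

/-- A space is a Bing compactum if it is compact metrizable and each of its connected
components is either a singleton or a hereditarily indecomposable continuum. -/
def IsBingCompactum (X : Type*) [TopologicalSpace X] : Prop :=
  CompactSpace X ∧ TopologicalSpace.MetrizableSpace X ∧
    ∀ x : X, (connectedComponent x).Subsingleton ∨
      HereditarilyIndecomposable (connectedComponent x)

/-- A space is hereditarily locally connected if each of its subcontinua, with the
subspace topology, is locally connected. -/
def HereditarilyLocallyConnected (Y : Type*) [TopologicalSpace Y] : Prop :=
  ∀ K : Set Y, IsSubcontinuum K → LocallyConnectedSpace K

open Set Filter Topology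

/-- A compact connected locally connected Hausdorff space is a point as soon as any two of its
intersecting subcontinua are comparable. -/
theorem subsingleton_of_subcontinua_comparable {R : Type*} [TopologicalSpace R] [CompactSpace R]
    [T2Space R] [PreconnectedSpace R] [LocallyConnectedSpace R]
    (h : ∀ A B : Set R, IsSubcontinuum A → IsSubcontinuum B → (A ∩ B).Nonempty →
      A ⊆ B ∨ B ⊆ A) : Subsingleton R := by
  have hbasis : ∀ x y : R, x ≠ y → ∃ A : Set R, IsSubcontinuum A ∧ A ∈ 𝓝 x ∧ y ∉ A := by
    intro x y hxy
    obtain ⟨N, hN, hNc, hNy⟩ := exists_mem_nhds_isClosed_subset (isOpen_ne.mem_nhds hxy)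
    obtain ⟨W, hWN, hWo, hxW, hWc⟩ :=
      locallyConnectedSpace_iff_subsets_isOpen_isConnected.1 ‹_› x N hN
    exact ⟨closure W, ⟨isClosed_closure.isCompact, hWc.closure⟩,
      mem_of_superset (hWo.mem_nhds hxW) subset_closure,
      fun hy => hNy (closure_minimal hWN hNc hy) rfl⟩
  refine ⟨fun a b => by_contra fun hab => ?_⟩
  obtain ⟨A, hA, haA, hbA⟩ := hbasis a b hab
  obtain ⟨x, hxA, hx⟩ : ∃ x ∈ A, A ∉ 𝓝 x := by
    by_contra! hcon
    have hclopen : IsClopen A := ⟨hA.1.isClosed, isOpen_iff_mem_nhds.2 hcon⟩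
    have := hclopen.eq_univ ⟨a, mem_of_mem_nhds haA⟩
    exact hbA (this ▸ mem_univ b)
  obtain ⟨B, hB, hxB, haB⟩ := hbasis x a (by rintro rfl; exact hx haA)
  rcases h A B hA hB ⟨x, hxA, mem_of_mem_nhds hxB⟩ with hAB | hBA
  · exact haB (hAB (mem_of_mem_nhds haA))
  · exact hx (mem_of_superset hxB hBA)

/-- Continuous images of continua are continua. -/
theorem IsSubcontinuum.image {X Y : Type*} [TopologicalSpace X] [TopologicalSpace Y] {K : Set X}
    (hK : IsSubcontinuum K) {f : X → Y} (hf : Continuous f) : IsSubcontinuum (f '' K) :=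
  ⟨hK.1.image hf, hK.2.image f hf.continuousOn⟩

/-- Every continuous map from a locally connected continuum to a Bing compactum is constant. -/
theorem IsBingCompactum.apply_eq_of_continuous {D X : Type*} [TopologicalSpace D]
    [TopologicalSpace X] (hX : IsBingCompactum X) [CompactSpace D] [PreconnectedSpace D]
    [LocallyConnectedSpace D] {f : D → X} (hf : Continuous f) (a b : D) : f a = f b := by
  obtain ⟨_, _, hcomp⟩ := hX
  have hsub : range f ⊆ connectedComponent (f a) :=
    (isPreconnected_range hf).subset_connectedComponent (mem_range_self a)
  rcases hcomp (f a) with hs | hind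
  · exact hs (hsub (mem_range_self a)) (hsub (mem_range_self b))
  have hq : IsQuotientMap (rangeFactorization f) :=
    hf.rangeFactorization.isClosedMap.isQuotientMap hf.rangeFactorization
      rangeFactorization_surjective
  have : CompactSpace (range f) := isCompact_iff_compactSpace.1 (isCompact_range hf)
  have : PreconnectedSpace (range f) := Subtype.preconnectedSpace (isPreconnected_range hf)
  have : LocallyConnectedSpace (range f) := hq.isCoinducing.locallyConnectedSpace
  have : Subsingleton (range f) := by
    refine subsingleton_of_subcontinua_comparable fun A B hA hB hAB => ?_
    have hval : ∀ S : Set (range f), Subtype.val '' S ⊆ connectedComponent (f a) :=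
      fun S => (Subtype.coe_image_subset _ S).trans hsub
    have hAB' : IsSubcontinuum (A ∪ B) := ⟨hA.1.union hB.1, hA.2.union hAB hB.2⟩
    rcases hind _ (hval (A ∪ B)) (hAB'.image continuous_subtype_val)
        _ (image_mono subset_union_left) _ (image_mono subset_union_right)
        (hA.image continuous_subtype_val) (hB.image continuous_subtype_val)
        (image_union _ _ _).symm with h | h
    · right
      rw [Subtype.val_injective.image_injective h]
      exact subset_union_right
    · left
      rw [Subtype.val_injective.image_injective h]
      exact subset_union_left
  exact congrArg Subtype.val (Subsingleton.elim (⟨f a, a, rfl⟩ : range f) ⟨f b, b, rfl⟩)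

/-- A finitely supported measure on a compact Hausdorff space vanishes if it annihilates a dense
set of continuous functions. -/
theorem Cp.finsupp_eq_zero_of_dense {X : Type*} [TopologicalSpace X] [CompactSpace X] [T2Space X]
    {D : Set (Cp X)} (hD : Dense D) (c : X →₀ ℝ)
    (h : ∀ f ∈ D, Finsupp.linearCombination ℝ (f : X → ℝ) c = 0) : c = 0 := by
  classical
  have hcont : Continuous fun f : Cp X => Finsupp.linearCombination ℝ (f : X → ℝ) c := by
    simp only [Finsupp.linearCombination_apply, Finsupp.sum, smul_eq_mul]
    refine continuous_finsetSum _ fun x _ => continuous_const.mul ?_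
    exact (continuous_apply x).comp continuous_subtype_val
  have hall : ∀ f : Cp X, Finsupp.linearCombination ℝ (f : X → ℝ) c = 0 := fun f =>
    congrFun (hcont.ext_on hD continuous_const h) f
  ext x
  by_contra hx
  obtain ⟨g, hg0, hg1, -⟩ := exists_continuous_zero_one_of_isClosed
    (s := (c.support.erase x : Set X)) (t := {x}) (Finset.finite_toSet _).isClosed
    isClosed_singleton (by simp)
  have := hall ⟨g, g.continuous⟩
  rw [Finsupp.linearCombination_apply, Finsupp.sum, Finset.sum_eq_single x] at this
  · simp only [hg1 (mem_singleton x), Pi.one_apply, smul_eq_mul, mul_one] at this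
    exact hx this
  · intro y hy hyx
    simp [hg0 (show y ∈ (c.support.erase x : Set X) by simp_all)]
  · intro hx'
    simp [Finsupp.notMem_support_iff.1 hx']

/-- If the topology is induced by a family of linear functionals, then every continuous linear
functional is a finite combination of them. -/
theorem exists_finsupp_eq_of_isInducing {V X : Type*} [AddCommGroup V] [Module ℝ V]
    [TopologicalSpace V] (ev : X → V →ₗ[ℝ] ℝ) (hev : IsInducing fun v x => ev x v)
    (φ : V →L[ℝ] ℝ) :
    ∃ c : X →₀ ℝ, ∀ v, φ v = Finsupp.linearCombination ℝ (fun x => ev x v) c := by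
  have htop : ⨅ x, .induced (ev x) inferInstance ≤ (inferInstance : TopologicalSpace V) := by
    rw [show (inferInstance : TopologicalSpace V) = _ from hev.eq_induced]
    simp only [Pi.topologicalSpace, induced_iInf, induced_compose]
    rfl
  have hφ : Continuous[⨅ x, .induced (ev x) inferInstance, inferInstance] φ.toLinearMap :=
    continuous_iff_le_induced.2 (htop.trans (continuous_iff_le_induced.1 φ.continuous))
  obtain ⟨c, hc⟩ := Finsupp.mem_span_range_iff_exists_finsupp.1
    ((LinearMap.mem_span_iff_continuous φ.toLinearMap).2 hφ)
  refine ⟨c, fun v => ?_⟩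
  rw [← φ.coe_coe, ← hc, Finsupp.linearCombination_apply]
  simp [Finsupp.sum]

/-- A continuous linear functional on a subspace of `C_p(X)` is a combination of evaluations. -/
theorem Cp.exists_finsupp_eq {X : Type*} [TopologicalSpace X] (E : Submodule ℝ (Cp X))
    (φ : E →L[ℝ] ℝ) :
    ∃ c : X →₀ ℝ, ∀ f : E, φ f = Finsupp.linearCombination ℝ ((f : Cp X) : X → ℝ) c := by
  have hind : IsInducing fun (f : E) (x : X) => ((f : Cp X) : X → ℝ) x :=
    IsInducing.subtypeVal.comp IsInducing.subtypeVal
  let ev : X → E →ₗ[ℝ] ℝ := fun x =>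
    { toFun := fun f => ((f : Cp X) : X → ℝ) x
      map_add' := fun _ _ => rfl
      map_smul' := fun _ _ => rfl }
  obtain ⟨c, hc⟩ := exists_finsupp_eq_of_isInducing (V := E) ev hind φ
  exact ⟨c, hc⟩

section BoundedReps

variable {V X Y : Type*} (ev : V → X → ℝ) (t : V → Y → ℝ)

/-- The pairs `(y, x)` for which the functional `v ↦ t v y` is a combination of the evaluations
`v ↦ ev v (x i)`, with coefficients bounded by `M`. -/
def boundedReps (n : ℕ) (M : ℝ) : Set (Y × (Fin n → X)) :=
  {p | ∃ a : Fin n → ℝ, (∀ i, |a i| ≤ M) ∧ ∀ v, t v p.1 = ∑ i, a i * ev v (p.2 i)}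

variable {ev t}

theorem isClosed_boundedReps [TopologicalSpace X] [TopologicalSpace Y]
    (hev : ∀ v, Continuous (ev v)) (ht : ∀ v, Continuous (t v)) (n : ℕ) (M : ℝ) :
    IsClosed (boundedReps ev t n M) := by
  let Z : Set ((Y × (Fin n → X)) × (Fin n → Icc (-M) M)) :=
    {q | ∀ v, t v q.1.1 = ∑ i, (q.2 i : ℝ) * ev v (q.1.2 i)}
  have hZ : IsClosed Z := by
    simp only [Z, ofPred_forall]
    refine isClosed_iInter fun v => isClosed_eq ((ht v).comp (by fun_prop)) ?_
    refine continuous_finsetSum _ fun i _ => Continuous.mul (by fun_prop) ?_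
    exact (hev v).comp (by fun_prop)
  convert isClosedMap_fst_of_compactSpace Z hZ using 1
  ext p
  constructor
  · rintro ⟨a, ha, hp⟩
    exact ⟨(p, fun i => ⟨a i, abs_le.1 (ha i)⟩), hp, rfl⟩
  · rintro ⟨⟨p, a⟩, hp, rfl⟩
    exact ⟨fun i => a i, fun i => abs_le.2 (a i).2, hp⟩

theorem boundedReps_perm {n : ℕ} {M : ℝ} {y : Y} {x : Fin n → X}
    (h : (y, x) ∈ boundedReps ev t n M) (σ : Equiv.Perm (Fin n)) :
    (y, x ∘ σ) ∈ boundedReps ev t n M := by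
  obtain ⟨a, ha, hp⟩ := h
  refine ⟨a ∘ σ, fun i => ha _, fun v => ?_⟩
  rw [hp v]
  exact (Equiv.sum_comp σ fun i => a i * ev v (x i)).symm

/-- A representation with a repeated point or a vanishing coefficient can be shortened. -/
theorem exists_boundedReps_pred {m : ℕ} {M : ℝ} {y : Y} {x : Fin (m + 1) → X}
    {a : Fin (m + 1) → ℝ} (ha : ∀ i, |a i| ≤ M)
    (hp : ∀ v, t v y = ∑ i, a i * ev v (x i))
    (h : ¬ (Function.Injective x ∧ ∀ i, a i ≠ 0)) :
    ∃ x' : Fin m → X, (y, x') ∈ boundedReps ev t m (M + M) := by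
  have hM : 0 ≤ M := (abs_nonneg _).trans (ha 0)
  by_cases hinj : Function.Injective x
  · obtain ⟨i, hi⟩ : ∃ i, a i = 0 := by
      by_contra! hcon
      exact h ⟨hinj, hcon⟩
    refine ⟨fun k => x (i.succAbove k), fun k => a (i.succAbove k),
      fun k => (ha _).trans (by linarith), fun v => ?_⟩
    rw [hp v, Fin.sum_univ_succAbove _ i, hi]
    simp
  · obtain ⟨i, j, hij, hne⟩ : ∃ i j, x i = x j ∧ i ≠ j := by
      simpa [Function.Injective] using hinj
    obtain ⟨l, rfl⟩ := Fin.exists_succAbove_eq hne.symm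
    refine ⟨fun k => x (i.succAbove k), fun k => a (i.succAbove k) + if k = l then a i else 0,
      fun k => ?_, fun v => ?_⟩
    · refine (abs_add_le _ _).trans (add_le_add (ha _) ?_)
      split_ifs
      · exact ha i
      · simpa using hM
    · rw [hp v, Fin.sum_univ_succAbove _ i]
      simp [add_mul, Finset.sum_add_distrib, ite_mul, hij, add_comm]

/-- The support of a reduced representation is contained in that of any other one. -/
theorem exists_eq_of_boundedReps
    (hsep : ∀ c : X →₀ ℝ, (∀ v, Finsupp.linearCombination ℝ (ev v) c = 0) → c = 0)
    {n : ℕ} {M : ℝ} {y : Y} {x x' : Fin n → X} {a : Fin n → ℝ}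
    (hx : Function.Injective x) (ha : ∀ i, a i ≠ 0) (hp : ∀ v, t v y = ∑ i, a i * ev v (x i))
    (h' : (y, x') ∈ boundedReps ev t n M) (i : Fin n) : ∃ j, x' j = x i := by
  classical
  obtain ⟨a', -, hp'⟩ := h'
  by_contra! hcon
  have hc := hsep (∑ k, Finsupp.single (x k) (a k) - ∑ k, Finsupp.single (x' k) (a' k))
    fun v => by
      simp only [map_sub, map_sum, Finsupp.linearCombination_single, smul_eq_mul]
      rw [← hp v, ← hp' v, sub_self]
  have := DFunLike.congr_fun hc (x i)
  simp [Finsupp.single_apply, hx.eq_iff, hcon] at this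
  exact ha i this

end BoundedReps

/-- A family of finitely supported functionals depending continuously on a point of a compact
Hausdorff space has, over some nonempty open set, supports given by finitely many continuous
functions. -/
theorem exists_continuousOn_support {V X Y : Type*} [TopologicalSpace X] [CompactSpace X]
    [T2Space X] [TopologicalSpace Y] [CompactSpace Y] [T2Space Y] [Nonempty Y]
    {ev : V → X → ℝ} {t : V → Y → ℝ}
    (hev : ∀ v, Continuous (ev v)) (ht : ∀ v, Continuous (t v))
    (hsep : ∀ c : X →₀ ℝ, (∀ v, Finsupp.linearCombination ℝ (ev v) c = 0) → c = 0)
    (hrep : ∀ y, ∃ c : X →₀ ℝ, ∀ v, t v y = Finsupp.linearCombination ℝ (ev v) c) :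
    ∃ (n : ℕ) (U : Set Y) (x : Y → Fin n → X), IsOpen U ∧ U.Nonempty ∧ ContinuousOn x U ∧
      ∀ y ∈ U, ∃ a : Fin n → ℝ, ∀ v, t v y = ∑ i, a i * ev v (x y i) := by
  classical
  let S : ℕ → ℕ → Set Y := fun n M => Prod.fst '' boundedReps ev t n M
  have hclosed : ∀ n (M : ℝ) (F : Set (Y × (Fin n → X))), IsClosed F →
      IsClosed (Prod.fst '' (boundedReps ev t n M ∩ F)) := fun n M F hF =>
    isClosedMap_fst_of_compactSpace _ ((isClosed_boundedReps hev ht n M).inter hF)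
  have hSclosed : ∀ n M, IsClosed (S n M) := fun n M =>
    isClosedMap_fst_of_compactSpace _ (isClosed_boundedReps hev ht n M)
  have hex : ∃ n M : ℕ, ∃ U : Set Y, IsOpen U ∧ U.Nonempty ∧ U ⊆ S n M := by
    have hcover : ⋃ q : ℕ × ℕ, S q.1 q.2 = univ := by
      refine eq_univ_of_forall fun y => ?_
      obtain ⟨c, hc⟩ := hrep y
      let e := c.support.equivFin.symm
      obtain ⟨M, hM⟩ := exists_nat_ge (∑ i, |c (e i)|)
      refine mem_iUnion.2 ⟨(c.support.card, M), (y, fun i => e i), ⟨fun i => c (e i), fun i => ?_,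
        fun v => ?_⟩, rfl⟩
      · exact (Finset.single_le_sum (f := fun i => |c (e i)|) (fun i _ => abs_nonneg _)
          (Finset.mem_univ i)).trans hM
      · rw [hc v, Finsupp.linearCombination_apply, Finsupp.sum, ← Finset.sum_coe_sort]
        exact (Equiv.sum_comp e fun p => c p * ev v p).symm
    obtain ⟨q, hq⟩ := nonempty_interior_of_iUnion_of_closed (fun q : ℕ × ℕ => hSclosed q.1 q.2)
      hcover
    exact ⟨q.1, q.2, _, isOpen_interior, hq, interior_subset⟩
  obtain ⟨n, ⟨M, U, hUo, hUne, hUS⟩, hmin⟩ := WellFounded.has_min (wellFounded_lt (α := ℕ))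
    {n | ∃ M : ℕ, ∃ U : Set Y, IsOpen U ∧ U.Nonempty ∧ U ⊆ S n M} hex
  obtain ⟨U', hU'o, hU'ne, hU'S, hred⟩ : ∃ U' : Set Y, IsOpen U' ∧ U'.Nonempty ∧ U' ⊆ S n M ∧
      ∀ y ∈ U', ∀ (x : Fin n → X) (a : Fin n → ℝ), (∀ i, |a i| ≤ M) →
        (∀ v, t v y = ∑ i, a i * ev v (x i)) → Function.Injective x ∧ ∀ i, a i ≠ 0 := by
    cases n with
    | zero =>
      exact ⟨U, hUo, hUne, hUS, fun y _ x a _ _ =>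
        ⟨Function.injective_of_subsingleton x, fun i => i.elim0⟩⟩
    | succ m =>
      refine ⟨U \ S m (M + M), hUo.sdiff (hSclosed _ _), ?_, sdiff_subset.trans hUS, ?_⟩
      · rw [sdiff_nonempty]
        exact fun hsub => hmin m ⟨M + M, U, hUo, hUne, hsub⟩ (Nat.lt_succ_self m)
      · rintro y ⟨-, hy⟩ x a ha hp
        by_contra hcon
        obtain ⟨x', hx'⟩ := exists_boundedReps_pred ha hp hcon
        exact hy ⟨(y, x'), by exact_mod_cast hx', rfl⟩
  have hsupp : ∀ y ∈ U', ∀ x x' : Fin n → X, (y, x) ∈ boundedReps ev t n M →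
      (y, x') ∈ boundedReps ev t n M → ∀ i, ∃ j, x' j = x i := by
    rintro y hy x x' ⟨a, ha, hp⟩ hx' i
    obtain ⟨hinj, hne⟩ := hred y hy x a ha hp
    exact exists_eq_of_boundedReps hsep hinj hne hp hx' i
  have hinj : ∀ y ∈ U', ∀ x : Fin n → X, (y, x) ∈ boundedReps ev t n M →
      Function.Injective x := by
    rintro y hy x ⟨a, ha, hp⟩
    exact (hred y hy x a ha hp).1
  obtain ⟨y₀, hy₀⟩ := hU'ne
  obtain ⟨x₀, hx₀⟩ : ∃ x₀, (y₀, x₀) ∈ boundedReps ev t n M := by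
    obtain ⟨⟨_, x₀⟩, hx₀, rfl⟩ := hU'S hy₀
    exact ⟨x₀, hx₀⟩
  have : Nonempty (Fin n → X) := ⟨x₀⟩
  obtain ⟨W, hW, hWdisj⟩ := (finite_range x₀).t2_separation
  have hN : ∀ i, ∃ N ∈ 𝓝 (x₀ i), IsClosed N ∧ N ⊆ W (x₀ i) := fun i =>
    exists_mem_nhds_isClosed_subset ((hW (x₀ i)).2.mem_nhds (hW (x₀ i)).1)
  choose N hNnhds hNclosed hNW using hN
  have hNdisj : ∀ i j p, p ∈ N i → p ∈ N j → i = j := by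
    intro i j p hi hj
    by_contra hij
    exact disjoint_left.1 (hWdisj (mem_range_self i) (mem_range_self j)
      ((hinj _ hy₀ _ hx₀).ne hij)) (hNW i hi) (hNW j hj)
  let F : Set (Y × (Fin n → X)) := {p | ∀ σ : Equiv.Perm (Fin n), ¬ ∀ i, p.2 (σ i) ∈ interior (N i)}
  have hF : IsClosed F := by
    simp only [F, ofPred_forall]
    refine isClosed_iInter fun σ => ?_
    rw [← compl_ofPred, isClosed_compl_iff]
    simp only [ofPred_forall]
    exact isOpen_iInter_of_finite fun i =>
      isOpen_interior.preimage ((continuous_apply (σ i)).comp continuous_snd)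
  let B := Prod.fst '' (boundedReps ev t n M ∩ F)
  have hB : IsClosed B := hclosed n M F hF
  have hy₀B : y₀ ∉ B := by
    rintro ⟨⟨_, x⟩, ⟨hx, hxF⟩, rfl⟩
    choose σ hσ using hsupp _ hy₀ x₀ x hx₀ hx
    have hσinj : Function.Injective σ := fun i j hij =>
      hinj _ hy₀ _ hx₀ (by rw [← hσ i, ← hσ j, hij])
    refine hxF (Equiv.ofBijective σ (Finite.injective_iff_bijective.1 hσinj)) fun i => ?_
    change x (σ i) ∈ interior (N i)
    rw [hσ i]
    exact mem_interior_iff_mem_nhds.2 (hNnhds i)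
  have hsel : ∀ y ∈ U' \ B, ∃ x : Fin n → X, (y, x) ∈ boundedReps ev t n M ∧ ∀ i, x i ∈ N i := by
    rintro y ⟨hyU, hyB⟩
    obtain ⟨⟨_, x⟩, hx, rfl⟩ := hU'S hyU
    obtain ⟨σ, hσ⟩ : ∃ σ : Equiv.Perm (Fin n), ∀ i, x (σ i) ∈ interior (N i) := by
      by_contra! hcon
      exact hyB ⟨_, ⟨hx, fun σ h => (hcon σ).elim fun i hi => hi (h i)⟩, rfl⟩
    exact ⟨x ∘ σ, boundedReps_perm hx σ, fun i => interior_subset (hσ i)⟩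
  have huniq : ∀ y ∈ U', ∀ x x' : Fin n → X, (y, x) ∈ boundedReps ev t n M →
      (y, x') ∈ boundedReps ev t n M → (∀ i, x i ∈ N i) → (∀ i, x' i ∈ N i) → x = x' := by
    intro y hy x x' hx hx' hxN hx'N
    funext i
    obtain ⟨j, hj⟩ := hsupp y hy x x' hx hx' i
    obtain rfl := hNdisj i j (x i) (hxN i) (hj ▸ hx'N j)
    exact hj.symm
  choose! x hx hxN using hsel
  refine ⟨n, U' \ B, x, hU'o.sdiff hB, ⟨y₀, hy₀, hy₀B⟩, ?_, fun y hy => ?_⟩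
  · refine continuousOn_iff_isClosed.2 fun K hK => ?_
    refine ⟨Prod.fst '' (boundedReps ev t n M ∩ {p | p.2 ∈ K ∧ ∀ i, p.2 i ∈ N i}),
      hclosed n M _ ?_, ?_⟩
    · have hcl : IsClosed {p : Y × (Fin n → X) | ∀ i, p.2 i ∈ N i} := by
        simp only [ofPred_forall]
        exact isClosed_iInter fun i =>
          (hNclosed i).preimage ((continuous_apply i).comp continuous_snd)
      exact (hK.preimage continuous_snd).inter hcl
    · ext y
      constructor
      · rintro ⟨hyK, hy⟩
        exact ⟨⟨(y, x y), ⟨hx y hy, hyK, hxN y hy⟩, rfl⟩, hy⟩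
      · rintro ⟨⟨⟨y, x'⟩, ⟨hx', hx'K, hx'N⟩, rfl⟩, hy⟩
        refine ⟨?_, hy⟩
        have := huniq y hy.1 _ _ (hx y hy) hx' (hxN y hy) hx'N
        exact mem_preimage.2 (this ▸ hx'K)
  · obtain ⟨a, -, hp⟩ := hx y hy
    exact ⟨a, hp⟩

/-- Infinitely many linearly independent functionals cannot be combinations of the same finitely
many functionals. -/
theorem not_infinite_of_forall_eq_sum {V Y : Type*} {t : V → Y → ℝ}
    (hsep : ∀ c : Y →₀ ℝ, (∀ v, Finsupp.linearCombination ℝ (t v) c = 0) → c = 0)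
    {n : ℕ} (e : V → Fin n → ℝ) {W : Set Y}
    (h : ∀ y ∈ W, ∃ a : Fin n → ℝ, ∀ v, t v y = ∑ i, a i * e v i) : ¬ W.Infinite := by
  intro hW
  have := hW.to_subtype
  choose a ha using fun y : W => h y y.2
  have hli : LinearIndependent ℝ a := by
    rw [linearIndependent_iff]
    intro c hc
    have hzero : c.mapDomain Subtype.val = 0 := hsep _ fun v => by
      rw [Finsupp.linearCombination_mapDomain, Finsupp.linearCombination_apply, Finsupp.sum]
      simp only [Function.comp_apply, ha, smul_eq_mul, Finset.mul_sum]
      rw [Finset.sum_comm]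
      refine Finset.sum_eq_zero fun i _ => ?_
      have := congrFun hc i
      rw [Finsupp.linearCombination_apply, Finsupp.sum, Finset.sum_apply] at this
      simp only [Pi.smul_apply, smul_eq_mul, Pi.zero_apply] at this
      simp only [← mul_assoc, ← Finset.sum_mul, this, zero_mul]
    exact Finsupp.mapDomain_injective Subtype.val_injective (hzero.trans Finsupp.mapDomain_zero.symm)
  have := hli.finite
  exact not_finite W

/-- Let `X` be a Bing compactum, `Y` a hereditarily locally connected compact metrizable
space, `E` a dense linear subspace of `C_p(X)` and `T : E → C_p(Y)` a continuous linear
map with dense image. Then `Y` is totally disconnected. -/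
theorem stmt2 (X Y : Type) [TopologicalSpace X] [TopologicalSpace Y]
    (hX : IsBingCompactum X)
    [CompactSpace Y] [TopologicalSpace.MetrizableSpace Y]
    (hY : HereditarilyLocallyConnected Y)
    (E : Submodule ℝ ↥(Cp X)) (hE : Dense (E : Set ↥(Cp X)))
    (T : ↥E →L[ℝ] ↥(Cp Y)) (hT : DenseRange T) :
    TotallyDisconnectedSpace Y := by
  have : CompactSpace X := hX.1
  have : TopologicalSpace.MetrizableSpace X := hX.2.1
  refine totallyDisconnectedSpace_iff_connectedComponent_subsingleton.2 fun y₀ => ?_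
  by_contra hnt
  rw [not_subsingleton_iff] at hnt
  let C := connectedComponent y₀
  have : CompactSpace C := isCompact_iff_compactSpace.1 isClosed_connectedComponent.isCompact
  have : ConnectedSpace C := Subtype.connectedSpace isConnected_connectedComponent
  have : Nontrivial C := nontrivial_coe_sort.2 hnt
  have : LocallyConnectedSpace C :=
    hY C ⟨isClosed_connectedComponent.isCompact, isConnected_connectedComponent⟩
  let ev : E → X → ℝ := fun f => ((f : Cp X) : X → ℝ)
  let t : E → C → ℝ := fun f y => (T f : Y → ℝ) y
  have hsepX : ∀ c : X →₀ ℝ, (∀ v, Finsupp.linearCombination ℝ (ev v) c = 0) → c = 0 :=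
    fun c hc => Cp.finsupp_eq_zero_of_dense hE c fun f hf => hc ⟨f, hf⟩
  have hsepC : ∀ c : C →₀ ℝ, (∀ v, Finsupp.linearCombination ℝ (t v) c = 0) → c = 0 := by
    intro c hc
    have hzero : c.mapDomain Subtype.val = 0 :=
      Cp.finsupp_eq_zero_of_dense hT _ (by
        rintro _ ⟨f, rfl⟩
        rw [Finsupp.linearCombination_mapDomain]
        exact hc f)
    exact Finsupp.mapDomain_injective Subtype.val_injective
      (hzero.trans Finsupp.mapDomain_zero.symm)
  have hrep : ∀ y, ∃ c : X →₀ ℝ, ∀ v, t v y = Finsupp.linearCombination ℝ (ev v) c := fun y =>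
    Cp.exists_finsupp_eq E (((ContinuousLinearMap.proj (y : Y)).comp (Cp Y).subtypeL).comp T)
  obtain ⟨n, U, x, hUo, ⟨z, hz⟩, hxc, hxrep⟩ := exists_continuousOn_support (ev := ev) (t := t)
    (fun f => (f : Cp X).2) (fun f => (T f).2.comp continuous_subtype_val) hsepX hrep
  obtain ⟨N, hN, hNc, hNU⟩ := exists_mem_nhds_isClosed_subset (hUo.mem_nhds hz)
  obtain ⟨W, hWN, hWo, hzW, hWc⟩ :=
    locallyConnectedSpace_iff_subsets_isOpen_isConnected.1 ‹_› z N hN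
  have hDU : closure W ⊆ U := (closure_minimal hWN hNc).trans hNU
  have hD : IsSubcontinuum (closure W) := ⟨isClosed_closure.isCompact, hWc.closure⟩
  have : CompactSpace (closure W) := isCompact_iff_compactSpace.1 hD.1
  have : PreconnectedSpace (closure W) := Subtype.preconnectedSpace hD.2.isPreconnected
  have : LocallyConnectedSpace (closure W) :=
    have := hY _ (hD.image continuous_subtype_val)
    (IsEmbedding.subtypeVal.homeomorphImage (closure W)).locallyConnectedSpace
  have hconst : ∀ y ∈ W, x y = x z := fun y hy => funext fun i =>
    hX.apply_eq_of_continuous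
      ((continuous_apply i).comp (continuousOn_iff_continuous_domRestrict.1 (hxc.mono hDU)))
      ⟨y, subset_closure hy⟩ ⟨z, subset_closure hzW⟩
  refine not_infinite_of_forall_eq_sum hsepC (fun f i => ev f (x z i)) (W := W) (fun y hy => ?_)
    (infinite_of_mem_nhds z (hWo.mem_nhds hzW))
  rw [← hconst y hy]
  exact hxrep y (hDU (subset_closure hy))
end

section
/- Let P be a nondegenerate (having more than one point) hereditarily indecomposable continuum. Then there is no surjective continuous linear map C_p(P) → C_p([0,1]); more generally, there is no continuous linear map from a dense linear subspace of C_p(P) into C_p([0,1]) whose image is dense in C_p([0,1]). -/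
theorem HereditarilyIndecomposable.apply_eq_of_continuous {P : Type*} [TopologicalSpace P]
    [T1Space P] (hP : HereditarilyIndecomposable (Set.univ : Set P)) {γ : ℝ → P}
    (hγ : Continuous γ) : γ 0 = γ 1 := by
  have hsub : ∀ a b : ℝ, a ≤ b → IsSubcontinuum (γ '' Set.Icc a b) := fun a b hab =>
    ⟨isCompact_Icc.image hγ, (isConnected_Icc hab).image γ hγ.continuousOn⟩
  set K := γ '' Set.Icc 0 1
  let S : Set ℝ := {c | c ∈ Set.Icc (0 : ℝ) 1 ∧ γ '' Set.Icc c 1 = K}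
  have h0S : (0 : ℝ) ∈ S := ⟨by simp, rfl⟩
  have hbdd : BddAbove S := ⟨1, fun c hc => hc.1.2⟩
  have key : ∀ y ∈ K, y = γ (sSup S) := by
    intro y hy
    by_contra hne
    have hnhds : {u | γ u ≠ y} ∈ nhds (sSup S) :=
      hγ.continuousAt.preimage_mem_nhds (isOpen_compl_singleton.mem_nhds (Ne.symm hne))
    obtain ⟨δ, hδ, hball⟩ := Metric.mem_nhds_iff.1 hnhds
    obtain ⟨c, hcS, hc⟩ := exists_lt_of_lt_csSup ⟨0, h0S⟩ (sub_lt_self (sSup S) hδ)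
    have hcs : c ≤ sSup S := le_csSup hbdd hcS
    have hs1 : sSup S ≤ 1 := csSup_le ⟨0, h0S⟩ fun c hc => hc.1.2
    have hfar : ∀ d < sSup S + δ, y ∉ γ '' Set.Icc c d := by
      rintro d hd ⟨u, ⟨huc, hud⟩, rfl⟩
      refine hball (a := u) ?_ rfl
      rw [Metric.mem_ball, Real.dist_eq, abs_lt]
      constructor <;> linarith
    rcases lt_or_ge 1 (sSup S + δ) with h1 | h1
    · exact hfar 1 h1 (hcS.2 ▸ hy)
    · set d := sSup S + δ / 2 with hd
      have hd1 : d ≤ 1 := by linarith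
      have hcd : c ≤ d := by linarith
      have hunion : γ '' Set.Icc c d ∪ γ '' Set.Icc d 1 = γ '' Set.Icc c 1 := by
        rw [← Set.image_union, Set.Icc_union_Icc_eq_Icc hcd hd1]
      rcases hP _ (Set.subset_univ _) (hsub c 1 (hcd.trans hd1)) _
        (hunion ▸ Set.subset_union_left) _ (hunion ▸ Set.subset_union_right)
        (hsub c d hcd) (hsub d 1 hd1) hunion with h | h
      · exact hfar d (by linarith) (h ▸ hcS.2 ▸ hy)
      · have : d ∈ S := ⟨⟨hcS.1.1.trans hcd, hd1⟩, h.trans hcS.2⟩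
        linarith [le_csSup hbdd this]
  exact (key _ ⟨0, by simp, rfl⟩).trans (key _ ⟨1, by simp, rfl⟩).symm

theorem HereditarilyIndecomposable.eq_of_joinedIn {P Y : Type*} [TopologicalSpace P] [T1Space P]
    [TopologicalSpace Y] (hP : HereditarilyIndecomposable (Set.univ : Set P)) {W : Set Y}
    {g : Y → P} (hg : ContinuousOn g W) {s t : Y} (h : JoinedIn W s t) : g s = g t := by
  obtain ⟨γ, hγ⟩ := h
  have hcont : Continuous fun r : ℝ => g (γ.extend r) :=
    hg.comp_continuous γ.continuous_extend fun r => hγ _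
  simpa using hP.apply_eq_of_continuous hcont

theorem exists_finsupp_of_isInducing {X M : Type*} [AddCommGroup M] [Module ℝ M]
    [TopologicalSpace M] {L : M →ₗ[ℝ] X → ℝ} (hL : Topology.IsInducing L) (φ : M →ₗ[ℝ] ℝ)
    (hφ : Continuous φ) : ∃ c : X →₀ ℝ, ∀ f, φ f = c.sum fun p a => a * L f p := by
  let ev : X → M →ₗ[ℝ] ℝ := fun p => LinearMap.proj p ∘ₗ L
  have hspan : φ ∈ Submodule.span ℝ (Set.range ev) := by
    rw [LinearMap.mem_span_iff_continuous]
    have htop : (⨅ p, TopologicalSpace.induced (ev p) inferInstance) = ‹TopologicalSpace M› := by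
      rw [hL.eq_induced, induced_to_pi]
      rfl
    rw [htop]
    exact hφ
  obtain ⟨c, hc⟩ := Finsupp.mem_span_range_iff_exists_finsupp.1 hspan
  refine ⟨c, fun f => ?_⟩
  simpa [Finsupp.sum, ev] using (congrArg (fun ψ : M →ₗ[ℝ] ℝ => ψ f) hc).symm

namespace Cp

theorem continuous_eval {X : Type*} [TopologicalSpace X] (x : X) :
    Continuous fun f : Cp X => f.1 x :=
  (continuous_apply x).comp continuous_subtype_val

theorem continuous_sum_eval {X ι : Type*} [TopologicalSpace X] (s : Finset ι) (x : ι → X)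
    (a : ι → ℝ) : Continuous fun f : Cp X => ∑ i ∈ s, a i * f.1 (x i) :=
  continuous_finsetSum _ fun i _ => continuous_const.mul (continuous_eval (x i))

theorem exists_eq_one_eq_zero {X : Type*} [TopologicalSpace X] [NormalSpace X] [T1Space X]
    {p : X} {F : Set X} (hF : F.Finite) (hp : p ∉ F) :
    ∃ f : Cp X, f.1 p = 1 ∧ ∀ q ∈ F, f.1 q = 0 := by
  obtain ⟨f, hf0, hf1, -⟩ := exists_continuous_zero_one_of_isClosed hF.isClosed
    (isClosed_singleton (x := p)) (Set.disjoint_singleton_right.2 hp)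
  exact ⟨⟨f, f.continuous⟩, hf1 rfl, fun q hq => hf0 hq⟩

theorem exists_finsupp_of_continuous {X : Type*} [TopologicalSpace X] {E : Submodule ℝ (Cp X)}
    (φ : E →L[ℝ] ℝ) : ∃ c : X →₀ ℝ, ∀ f : E, φ f = c.sum fun p a => a * f.1.1 p :=
  exists_finsupp_of_isInducing (M := E) (L := (Cp X).subtype ∘ₗ E.subtype)
    (Topology.IsInducing.subtypeVal.comp Topology.IsInducing.subtypeVal) φ.toLinearMap φ.continuous

theorem sum_eq_sum_of_dense {X ι κ : Type*} [TopologicalSpace X] [Fintype ι] [Fintype κ]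
    {E : Set (Cp X)} (hE : Dense E) {x : ι → X} {a : ι → ℝ} {y : κ → X} {b : κ → ℝ}
    (h : ∀ f ∈ E, ∑ i, a i * f.1 (x i) = ∑ j, b j * f.1 (y j)) (f : Cp X) :
    ∑ i, a i * f.1 (x i) = ∑ j, b j * f.1 (y j) := by
  exact congrFun (Continuous.ext_on hE (continuous_sum_eval _ x a) (continuous_sum_eval _ y b) h) f

/-- Points `x i` taken from prescribed sets `C i`, together with coefficients `a i` bounded and
bounded away from zero by `N + 1`. -/
def atomBox {X : Type*} {n : ℕ} (C : Fin n → Set X) (N : ℕ) : Set ((Fin n → X) × (Fin n → ℝ)) :=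
  Set.univ.pi C ×ˢ Set.univ.pi fun _ => {r : ℝ | |r| ≤ N + 1 ∧ (N + 1 : ℝ)⁻¹ ≤ |r|}

/-- The finitely supported measure `∑ a i • δ (x i)` as a functional on `E`. -/
def atomic {X : Type*} [TopologicalSpace X] (E : Submodule ℝ (Cp X)) {n : ℕ}
    (z : (Fin n → X) × (Fin n → ℝ)) : E → ℝ :=
  fun f => ∑ i, z.2 i * f.1.1 (z.1 i)

theorem continuous_atomic {X : Type*} [TopologicalSpace X] (E : Submodule ℝ (Cp X)) (n : ℕ) :
    Continuous (atomic E (n := n)) := by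
  refine continuous_pi fun f => continuous_finsetSum _ fun i _ => ?_
  have hf : Continuous f.1.1 := f.1.2
  exact ((continuous_apply i).comp continuous_snd).mul
    (hf.comp ((continuous_apply i).comp continuous_fst))

theorem isCompact_atomBox {X : Type*} [TopologicalSpace X] [CompactSpace X] {n : ℕ}
    {C : Fin n → Set X} (hC : ∀ i, IsClosed (C i)) (N : ℕ) : IsCompact (atomBox C N) := by
  refine (isCompact_univ_pi fun i => (hC i).isCompact).prod
    (isCompact_univ_pi (X := fun _ => ℝ) fun _ => ?_)
  refine (isCompact_Icc (a := -(N + 1 : ℝ)) (b := N + 1)).of_isClosed_subset ?_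
    fun r hr => abs_le.1 hr.1
  exact (isClosed_le continuous_abs continuous_const).inter
    (isClosed_le continuous_const continuous_abs)

theorem injOn_atomic {X : Type*} [TopologicalSpace X] [NormalSpace X] [T1Space X]
    {E : Submodule ℝ (Cp X)} (hE : Dense (E : Set (Cp X))) {n : ℕ} {C : Fin n → Set X}
    (hC : Pairwise fun i j => Disjoint (C i) (C j)) (N : ℕ) :
    Set.InjOn (atomic E) (atomBox C N) := by
  rintro ⟨x, a⟩ hx ⟨y, b⟩ hy hxy
  have hxC : ∀ i, x i ∈ C i := fun i => hx.1 i trivial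
  have hyC : ∀ i, y i ∈ C i := fun i => hy.1 i trivial
  have hne : ∀ i j, i ≠ j → ∀ p ∈ C i, ∀ q ∈ C j, p ≠ q := fun i j hij p hp q hq h =>
    Set.disjoint_left.1 (hC hij) hp (h ▸ hq)
  have ha : ∀ i, a i ≠ 0 := fun i h => by
    have : (N + 1 : ℝ)⁻¹ ≤ |a i| := (hx.2 i trivial).2
    rw [h, abs_zero] at this
    exact absurd this (not_le.2 (by positivity))
  have heq := sum_eq_sum_of_dense hE (x := x) (a := a) (y := y) (b := b)
    fun f hf => congrFun hxy ⟨f, hf⟩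
  have hsum : ∀ (i : Fin n) (f : Cp X) (z : Fin n → X) (c : Fin n → ℝ),
      (∀ j ≠ i, f.1 (z j) = 0) → ∑ j, c j * f.1 (z j) = c i * f.1 (z i) :=
    fun i f z c h => Fintype.sum_eq_single i fun j hj => by rw [h j hj, mul_zero]
  have hpt : ∀ i, x i = y i := by
    intro i
    by_contra hi
    obtain ⟨f, hf1, hf0⟩ := exists_eq_one_eq_zero (p := x i) (F := x '' {i}ᶜ ∪ Set.range y)
      ((Set.toFinite _).union (Set.toFinite _)) (by
        rintro (⟨j, hj, h⟩ | ⟨j, h⟩)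
        · exact hne j i hj _ (hxC j) _ (hxC i) h
        · rcases eq_or_ne j i with rfl | hj
          · exact hi h.symm
          · exact hne j i hj _ (hyC j) _ (hxC i) h)
    have := heq f
    rw [hsum i f x a fun j hj => hf0 _ (Or.inl ⟨j, hj, rfl⟩),
      hsum i f y b fun j hj => hf0 _ (Or.inr ⟨j, rfl⟩), hf1, hf0 _ (Or.inr ⟨i, rfl⟩)] at this
    exact ha i (by simpa using this)
  obtain rfl : x = y := funext hpt
  refine Prod.ext rfl (funext fun i => ?_)
  obtain ⟨f, hf1, hf0⟩ := exists_eq_one_eq_zero (p := x i) (F := x '' {i}ᶜ)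
    (Set.toFinite _) (by
      rintro ⟨j, hj, h⟩
      exact hne j i hj _ (hxC j) _ (hxC i) h)
  have := heq f
  rw [hsum i f x a fun j hj => hf0 _ ⟨j, hj, rfl⟩,
    hsum i f x b fun j hj => hf0 _ ⟨j, hj, rfl⟩, hf1] at this
  simpa using this

/-- The atomic functionals on a compact metrizable space are covered by countably many
injectively parametrized compact families. -/
theorem exists_mem_image_atomBox {X : Type*} [TopologicalSpace X] [CompactSpace X]
    [T2Space X] [SecondCountableTopology X] {E : Submodule ℝ (Cp X)} (φ : E →L[ℝ] ℝ) :
    ∃ (n : ℕ) (V : Fin n → TopologicalSpace.countableBasis X) (N : ℕ),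
      (Pairwise fun i j => Disjoint (closure (V i : Set X)) (closure (V j : Set X))) ∧
      (φ : E → ℝ) ∈ atomic E '' atomBox (fun i => closure (V i : Set X)) N := by
  obtain ⟨c, hc⟩ := exists_finsupp_of_continuous φ
  let e := c.support.equivFin.symm
  let x : Fin c.support.card → X := fun i => e i
  have hx : Function.Injective x := Subtype.val_injective.comp e.injective
  obtain ⟨U, hU, hdisj⟩ := c.support.finite_toSet.t2_separation
  have hV : ∀ i, ∃ V : TopologicalSpace.countableBasis X,
      x i ∈ (V : Set X) ∧ closure (V : Set X) ⊆ U (x i) := by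
    intro i
    obtain ⟨V, hVb, hxV, hVU⟩ := (TopologicalSpace.isBasis_countableBasis X).exists_closure_subset
      ((hU (x i)).2.mem_nhds (hU (x i)).1)
    exact ⟨⟨V, hVb⟩, hxV, hVU⟩
  choose V hxV hVU using hV
  have hN : ∃ N : ℕ, ∀ i, |c (x i)| ≤ N + 1 ∧ (N + 1 : ℝ)⁻¹ ≤ |c (x i)| := by
    have hev : ∀ i, ∀ᶠ N : ℕ in Filter.atTop,
        |c (x i)| ≤ N + 1 ∧ (N + 1 : ℝ)⁻¹ ≤ |c (x i)| := by
      intro i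
      have h0 : 0 < |c (x i)| := abs_pos.2 (Finsupp.mem_support_iff.1 (e i).2)
      filter_upwards [(tendsto_natCast_atTop_atTop (R := ℝ)).eventually_ge_atTop |c (x i)|,
        (tendsto_natCast_atTop_atTop (R := ℝ)).eventually_ge_atTop |c (x i)|⁻¹] with N h1 h2
      exact ⟨by linarith, inv_le_of_inv_le₀ h0 (by linarith)⟩
    exact (Filter.eventually_all.2 hev).exists
  obtain ⟨N, hN⟩ := hN
  refine ⟨_, V, N, fun i j hij => ?_, (x, fun i => c (x i)), ⟨fun i _ => subset_closure (hxV i),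
    fun i _ => hN i⟩, funext fun f => ?_⟩
  · exact (hdisj (e i).2 (e j).2 (hx.ne hij)).mono (hVU i) (hVU j)
  · rw [hc f, Finsupp.sum, ← Finset.sum_coe_sort]
    exact Equiv.sum_comp e fun p : c.support => c p * f.1.1 p

/-- Dense range makes the dual map injective on finitely supported measures. -/
theorem coeff_eq_zero_of_denseRange {X Z : Type*} [TopologicalSpace X] [NormalSpace X]
    [T1Space X] {T : Z → Cp X} (hT : DenseRange T) {s : Finset X} {c : X → ℝ}
    (h : ∀ z, ∑ t ∈ s, c t * (T z).1 t = 0) {t : X} (ht : t ∈ s) : c t = 0 := by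
  have hall : (fun f : Cp X => ∑ t ∈ s, c t * f.1 t) = fun _ => 0 :=
    hT.equalizer (continuous_sum_eval s id c) continuous_const (funext h)
  obtain ⟨f, hf1, hf0⟩ := exists_eq_one_eq_zero (p := t) (F := (s : Set X) \ {t})
    (s.finite_toSet.subset Set.sdiff_subset) (by simp)
  have := congrFun hall f
  rw [Finset.sum_eq_single_of_mem t ht fun q hq hqt => by rw [hf0 q ⟨hq, hqt⟩, mul_zero], hf1]
    at this
  simpa using this

theorem not_denseRange {P : Type*} [TopologicalSpace P] [CompactSpace P]
    [TopologicalSpace.MetrizableSpace P]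
    (hP : HereditarilyIndecomposable (Set.univ : Set P)) {E : Submodule ℝ (Cp P)}
    (T : E →L[ℝ] Cp unitInterval) (hE : Dense (E : Set (Cp P))) : ¬ DenseRange T := by
  intro hT
  let := TopologicalSpace.metrizableSpaceMetric P
  have : SecondCountableTopology P := UniformSpace.secondCountable_of_separable P
  let μ : unitInterval → E → ℝ := fun t f => (T f).1 t
  have hμ : Continuous μ := continuous_pi fun f => (T f).2
  let ι := {i : Σ n : ℕ, (Fin n → TopologicalSpace.countableBasis P) × ℕ //
    Pairwise fun j k => Disjoint (closure (i.2.1 j : Set P)) (closure (i.2.1 k : Set P))}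
  have : Countable (TopologicalSpace.countableBasis P) :=
    (TopologicalSpace.countable_countableBasis P).to_subtype
  let B : (i : ι) → Set ((Fin i.1.1 → P) × (Fin i.1.1 → ℝ)) := fun i =>
    atomBox (fun j => closure (i.1.2.1 j : Set P)) i.1.2.2
  have hB : ∀ i, IsCompact (B i) := fun i => isCompact_atomBox (fun _ => isClosed_closure) _
  have hclosed : ∀ i, IsClosed (μ ⁻¹' (atomic E '' B i)) := fun i =>
    ((hB i).image (continuous_atomic E _)).isClosed.preimage hμ
  have hcover : ⋃ i, μ ⁻¹' (atomic E '' B i) = Set.univ := by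
    refine Set.eq_univ_of_forall fun t => Set.mem_iUnion.2 ?_
    obtain ⟨n, V, N, hV, hmem⟩ := exists_mem_image_atomBox
      ((⟨LinearMap.proj t ∘ₗ (Cp unitInterval).subtype, continuous_eval t⟩ :
        Cp unitInterval →L[ℝ] ℝ).comp T)
    exact ⟨⟨⟨n, V, N⟩, hV⟩, hmem⟩
  obtain ⟨i, t₀, ht₀⟩ := nonempty_interior_of_iUnion_of_closed hclosed hcover
  let W := interior (μ ⁻¹' (atomic E '' B i))
  have hWB : ∀ t ∈ W, ∃ z ∈ B i, atomic E z = μ t := fun t ht =>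
    interior_subset (s := μ ⁻¹' (atomic E '' B i)) ht
  have : Nonempty ((Fin i.1.1 → P) × (Fin i.1.1 → ℝ)) := ⟨(hWB t₀ ht₀).choose⟩
  have : CompactSpace (B i) := isCompact_iff_compactSpace.1 (hB i)
  have hemb := ((continuous_atomic E _).comp continuous_subtype_val).isClosedEmbedding
    (Set.injOn_iff_injective.1 (injOn_atomic hE i.2 _) : Function.Injective fun z : B i => _)
  choose! z hzB hz using hWB
  have hzcont : ContinuousOn z W := by
    rw [continuousOn_iff_continuous_domRestrict]
    refine continuous_subtype_val.comp (f := fun t : W => (⟨z t, hzB t t.2⟩ : B i)) ?_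
    rw [hemb.isInducing.continuous_iff]
    have : (fun z : B i => atomic E z.1) ∘ (fun t : W => (⟨z t, hzB t t.2⟩ : B i)) =
        fun t : W => μ t := funext fun t => hz t t.2
    exact this ▸ hμ.comp continuous_subtype_val
  have : LocallyPathConnectedSpace unitInterval := (convex_Icc (0 : ℝ) 1).locallyPathConnectedSpace
  obtain ⟨V, ⟨hVnhds, hVconn⟩, hVW⟩ := (path_connected_basis t₀).mem_iff.1
    (isOpen_interior.mem_nhds ht₀)
  have hconst : ∀ t ∈ V, (z t).1 = (z t₀).1 := fun t ht => funext fun j =>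
    hP.eq_of_joinedIn (g := fun t => (z t).1 j)
      (((continuous_apply j).comp continuous_fst).comp_continuousOn hzcont)
      ((hVconn.joinedIn t ht t₀ (mem_of_mem_nhds hVnhds)).mono hVW)
  have : Infinite V := (infinite_of_mem_nhds t₀ hVnhds).to_subtype
  have hdep := Module.Finite.not_linearIndependent_of_infinite (R := ℝ) fun t : V => (z t).2
  rw [not_linearIndependent_iff] at hdep
  obtain ⟨s, c, hc, t₁, ht₁, hct₁⟩ := hdep
  apply hct₁
  classical
  let c' : unitInterval → ℝ := fun t => if h : t ∈ V then c ⟨t, h⟩ else 0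
  have hc' : ∀ t : V, c' t = c t := fun t => by simp [c']
  rw [← hc']
  refine coeff_eq_zero_of_denseRange hT (s := s.map (Function.Embedding.subtype _)) (c := c')
    (fun f => ?_) (Finset.mem_map_of_mem _ ht₁)
  rw [Finset.sum_map]
  calc ∑ t ∈ s, c' t * (T f).1 t
      = ∑ t ∈ s, ∑ j, (c t * (z t).2 j) * f.1.1 ((z t₀).1 j) := by
        refine Finset.sum_congr rfl fun t _ => ?_
        have h : (T f).1 t = ∑ j, (z t).2 j * f.1.1 ((z t).1 j) :=
          (congrFun (hz t (hVW t.2)) f).symm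
        rw [hc', h, hconst t t.2, Finset.mul_sum]
        simp only [mul_assoc]
    _ = ∑ j, (∑ t ∈ s, c t • (z t).2) j * f.1.1 ((z t₀).1 j) := by
        rw [Finset.sum_comm]
        simp [Finset.sum_mul]
    _ = 0 := by rw [hc]; simp

end Cp

/-- Let `P` be a nondegenerate hereditarily indecomposable continuum. Then there is no
surjective continuous linear map `C_p(P) → C_p([0,1])`, and, more generally, there is no
continuous linear map from a dense linear subspace of `C_p(P)` into `C_p([0,1])` with
dense image. -/
theorem stmt3 (P : Type) [TopologicalSpace P] [CompactSpace P]
    [TopologicalSpace.MetrizableSpace P] [ConnectedSpace P] [Nontrivial P]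
    (hP : HereditarilyIndecomposable (Set.univ : Set P)) :
    (¬ ∃ T : ↥(Cp P) →L[ℝ] ↥(Cp unitInterval), Function.Surjective T) ∧
    (¬ ∃ (E : Submodule ℝ ↥(Cp P)) (T : ↥E →L[ℝ] ↥(Cp unitInterval)),
        Dense (E : Set ↥(Cp P)) ∧ DenseRange T) := by
  have hdense : ¬ ∃ (E : Submodule ℝ ↥(Cp P)) (T : ↥E →L[ℝ] ↥(Cp unitInterval)),
      Dense (E : Set ↥(Cp P)) ∧ DenseRange T :=
    fun ⟨_, T, hE, hT⟩ => Cp.not_denseRange hP T hE hT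
  refine ⟨fun ⟨T, hT⟩ => hdense ⟨⊤, T.comp (⊤ : Submodule ℝ (Cp P)).subtypeL, by simp, ?_⟩, hdense⟩
  refine Function.Surjective.denseRange fun g => ?_
  obtain ⟨f, rfl⟩ := hT g
  exact ⟨⟨f, trivial⟩, rfl⟩
end
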